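/- Evaluation of strictly convergent series is multiplicative: let m ∈ ℕ, γ : Fin m → ℝ, let f, g : (Fin m → ℤ) → Λ both be strictly convergent relative to γ, let h be their convolution h α = Σ_ν f ν · g(α − ν), and let y : Fin m → Λ with v(y i) = γ i for all i. Then the three families ν ↦ f ν · ∏_i (y i)^(ν i), ν ↦ g ν · ∏_i (y i)^(ν i), and α ↦ h α · ∏_i (y i)^(α i) are all summable families, and Σ_α h α · ∏_i (y i)^(α i) = (Σ_ν f ν · ∏_i (y i)^(ν i)) · (Σ_ν g ν · ∏_i (y i)^(ν i)). -/

import Mathlib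

/-- The Novikov-type field: Hahn series with real exponents and complex coefficients. -/
noncomputable abbrev Λ : Type := HahnSeries ℝ ℂ

/-- The canonical additive valuation on `Λ`. -/
noncomputable def v (x : Λ) : WithTop ℝ := HahnSeries.addVal ℝ ℂ x

/-- `f : (Fin m → ℤ) → Λ` is strictly convergent relative to `γ : Fin m → ℝ` if for every
`r ∈ ℝ` the set `{ν | f ν ≠ 0 ∧ v (f ν) + ⟨ν, γ⟩ ≤ r}` is finite. -/
def StrictConv (m : ℕ) (γ : Fin m → ℝ) (f : (Fin m → ℤ) → Λ) : Prop :=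
  ∀ r : ℝ, {ν : Fin m → ℤ | f ν ≠ 0 ∧
    v (f ν) + ((∑ i, (ν i : ℝ) * γ i : ℝ) : WithTop ℝ) ≤ (r : WithTop ℝ)}.Finite

namespace HahnSeries

/-- A family of Hahn series whose orders tend to infinity along the cofinite filter is summable. -/
def SummableFamily.ofFiniteOrderTopLE {Γ R ι : Type*} [LinearOrder Γ] [AddCommMonoid R]
    (a : ι → HahnSeries Γ R) (ha : ∀ r : Γ, {i | (a i).orderTop ≤ r}.Finite) :
    SummableFamily Γ R ι where
  toFun := a
  isPWO_iUnion_support' := by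
    rw [Set.isPWO_iff_isWF, Set.isWF_iff_no_descending_seq]
    intro u hu hmem
    have hpwo : (⋃ i ∈ (ha (u 0)).toFinset, (a i).support).IsPWO :=
      (Finset.isPWO_bUnion _).2 fun i _ => (a i).isPWO_support
    refine Set.isWF_iff_no_descending_seq.1 hpwo.isWF u hu fun n => ?_
    obtain ⟨i, hi⟩ := Set.mem_iUnion.1 (hmem n)
    exact Set.mem_biUnion ((ha (u 0)).mem_toFinset.2 ((orderTop_le_of_coeff_ne_zero hi).trans
      (WithTop.coe_le_coe.2 (hu.antitone n.zero_le)))) hi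
  finite_co_support' := fun r => (ha r).subset fun _ hi => orderTop_le_of_coeff_ne_zero hi

namespace SummableFamily

variable {Γ R α β : Type*} [PartialOrder Γ] [AddCommMonoid R]

/-- The restriction of a summable family on a product to a fibre of the first projection. -/
def fiber (s : SummableFamily Γ R (α × β)) (a : α) : SummableFamily Γ R β where
  toFun b := s (a, b)
  isPWO_iUnion_support' := s.isPWO_iUnion_support.mono <| Set.iUnion_subset fun b =>
    Set.subset_iUnion (fun p => (s p).support) (a, b)
  finite_co_support' g := Set.Finite.preimage (Prod.mk_right_injective a).injOn
    (s.finite_co_support g)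

/-- The family of the sums over the fibres of the first projection. -/
noncomputable def fiberHsum (s : SummableFamily Γ R (α × β)) : SummableFamily Γ R α where
  toFun a := (s.fiber a).hsum
  isPWO_iUnion_support' := s.isPWO_iUnion_support.mono <| Set.iUnion_subset fun a =>
    support_hsum_subset.trans <| Set.iUnion_subset fun b =>
      Set.subset_iUnion (fun p => (s p).support) (a, b)
  finite_co_support' g := by
    refine (Set.Finite.image Prod.fst (s.finite_co_support g)).subset fun a ha => ?_
    rw [Set.mem_ofPred, coeff_hsum] at ha
    obtain ⟨b, hb⟩ := not_forall.1 (mt finsum_eq_zero_of_forall_eq_zero ha)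
    exact ⟨(a, b), hb, rfl⟩

theorem hsum_fiberHsum (s : SummableFamily Γ R (α × β)) : s.fiberHsum.hsum = s.hsum := by
  ext g
  rw [coeff_hsum, coeff_hsum, finsum_curry _ (s.finite_co_support g)]
  exact finsum_congr fun a => coeff_hsum

end SummableFamily

end HahnSeries

theorem AddValuation.map_zpow_eq_coe {K : Type*} [Field K] (w : AddValuation K (WithTop ℝ))
    {x : K} {c : ℝ} (hx : w x = (c : WithTop ℝ)) (n : ℤ) :
    w (x ^ n) = ((n * c : ℝ) : WithTop ℝ) := by
  have hpow (k : ℕ) : w (x ^ k) = ((k * c : ℝ) : WithTop ℝ) := by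
    rw [w.map_pow, hx, ← WithTop.coe_nsmul, nsmul_eq_mul]
  obtain ⟨k, rfl | rfl⟩ := n.eq_nat_or_neg
  · simpa using hpow k
  · have hx0 : x ≠ 0 := by
      rintro rfl
      simp at hx
    have hmul : w (x ^ (-(k : ℤ))) + w (x ^ k) = 0 := by
      rw [← w.map_mul, zpow_neg, zpow_natCast, inv_mul_cancel₀ (pow_ne_zero k hx0), w.map_one]
    rw [hpow k] at hmul
    obtain ⟨d, hd⟩ := WithTop.ne_top_iff_exists.1
      (show w (x ^ (-(k : ℤ))) ≠ ⊤ from fun htop => by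
        rw [htop, top_add] at hmul
        exact WithTop.top_ne_zero hmul)
    rw [← hd] at hmul ⊢
    norm_cast at hmul ⊢
    push_cast
    linarith

theorem AddValuation.map_prod_zpow_eq_coe {K ι : Type*} [Field K]
    (w : AddValuation K (WithTop ℝ)) (s : Finset ι) {y : ι → K} {γ : ι → ℝ}
    (hy : ∀ i, w (y i) = (γ i : WithTop ℝ)) (n : ι → ℤ) :
    w (∏ i ∈ s, y i ^ n i) = ((∑ i ∈ s, (n i : ℝ) * γ i : ℝ) : WithTop ℝ) := by
  classical
  induction s using Finset.induction_on with
  | empty => simp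
  | insert i s hi ih =>
    rw [Finset.prod_insert hi, Finset.sum_insert hi, w.map_mul, ih, w.map_zpow_eq_coe (hy i),
      WithTop.coe_add]

theorem StrictConv.finite_orderTop_le {m : ℕ} {γ : Fin m → ℝ} {f : (Fin m → ℤ) → Λ}
    (hf : StrictConv m γ f) {y : Fin m → Λ} (hy : ∀ i, v (y i) = ((γ i : ℝ) : WithTop ℝ)) (r : ℝ) :
    {ν | (f ν * ∏ i, y i ^ ν i).orderTop ≤ (r : WithTop ℝ)}.Finite := by
  refine (hf r).subset fun ν hν => ?_
  rw [Set.mem_ofPred, ← HahnSeries.addVal_apply, AddValuation.map_mul,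
    AddValuation.map_prod_zpow_eq_coe _ _ hy] at hν
  refine ⟨fun h0 => ?_, hν⟩
  rw [h0, AddValuation.map_zero, top_add] at hν
  exact WithTop.coe_ne_top (top_le_iff.1 hν)

/-- The pairs `(α, ν)` correspond to the pairs `(ν, α - ν)`, of sum `α`. -/
def prodEquivSub (G : Type*) [AddCommGroup G] : G × G ≃ G × G where
  toFun p := (p.2, p.1 - p.2)
  invFun q := (q.1 + q.2, q.1)
  left_inv p := by simp
  right_inv q := by simp

/-- Evaluation of strictly convergent series is multiplicative: if `h` is the convolution
of `f` and `g` and `v (y i) = γ i` for all `i`, then the evaluation families of `f`, `g`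
and `h` at `y` are summable and the evaluation of `h` is the product of the evaluations
of `f` and `g`. -/
theorem evaluation_multiplicative (m : ℕ) (γ : Fin m → ℝ)
    (f g : (Fin m → ℤ) → Λ) (hf : StrictConv m γ f) (hg : StrictConv m γ g)
    (h : (Fin m → ℤ) → Λ)
    (hconv : ∀ α : Fin m → ℤ, ∃ s : HahnSeries.SummableFamily ℝ ℂ (Fin m → ℤ),
      (∀ ν, s ν = f ν * g (α - ν)) ∧ s.hsum = h α)
    (y : Fin m → Λ) (hy : ∀ i, v (y i) = ((γ i : ℝ) : WithTop ℝ)) :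
    ∃ (sf sg sh : HahnSeries.SummableFamily ℝ ℂ (Fin m → ℤ)),
      (∀ ν, sf ν = f ν * ∏ i, (y i) ^ (ν i)) ∧
      (∀ ν, sg ν = g ν * ∏ i, (y i) ^ (ν i)) ∧
      (∀ α, sh α = h α * ∏ i, (y i) ^ (α i)) ∧
      sh.hsum = sf.hsum * sg.hsum := by
  have hy0 (i) : y i ≠ 0 := by
    intro h0
    have := hy i
    simp [v, h0] at this
  let sf := HahnSeries.SummableFamily.ofFiniteOrderTopLE _ (hf.finite_orderTop_le hy)
  let sg := HahnSeries.SummableFamily.ofFiniteOrderTopLE _ (hg.finite_orderTop_le hy)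
  let t := HahnSeries.SummableFamily.Equiv (prodEquivSub (Fin m → ℤ)).symm (sf.mul sg)
  refine ⟨sf, sg, t.fiberHsum, fun _ => rfl, fun _ => rfl, fun α => ?_, ?_⟩
  · obtain ⟨s, hs, hsum⟩ := hconv α
    have hfiber : t.fiber α = (∏ i, y i ^ α i) • s := by
      ext1 ν
      have hprod : ∏ i, y i ^ α i = (∏ i, y i ^ ν i) * ∏ i, y i ^ (α - ν) i := by
        rw [← Finset.prod_mul_distrib]
        exact Finset.prod_congr rfl fun i _ => by
          rw [← zpow_add₀ (hy0 i), Pi.sub_apply, add_sub_cancel]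
      rw [HahnSeries.SummableFamily.smul_apply, hs, HahnSeries.of_symm_smul_of_eq_mul, hprod]
      change (f ν * ∏ i, y i ^ ν i) * (g (α - ν) * ∏ i, y i ^ (α - ν) i) = _
      ring
    change (t.fiber α).hsum = _
    rw [hfiber, HahnSeries.SummableFamily.hsum_smul, hsum, mul_comm]
  · rw [HahnSeries.SummableFamily.hsum_fiberHsum, HahnSeries.SummableFamily.hsum_equiv,
      HahnSeries.SummableFamily.hsum_mul]
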